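/- Let d ≥ 1, let (τ_k)_{k∈ℤ^d} be an ergodic measure-preserving action of ℤ^d on a probability space (Ω, ℱ, ℙ), and let 1 ≤ p < ∞. Then the linear span of the functions Φ_{χ,Y}(ω,x) = Σ_{k∈ℤ^d} Y(τ_k(ω)) χ(x−k), where Y ranges over L^∞(Ω) and χ ranges over the Schwartz space 𝒮(ℝ^d), is dense in L^p_s: for every stationary f with E(∫_Q |f|^p) < ∞ and every ε > 0 there is a finite linear combination Φ of such functions with E(∫_Q |f − Φ|^p) < ε^p. -/

import Mathlib

open MeasureTheory Set
open scoped ENNReal NNReal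

noncomputable section

/-- The unit cube `Q = [-1/2, 1/2)^d`. -/
def unitCube (d : ℕ) : Set (Fin d → ℝ) :=
  {x | ∀ i, x i ∈ Set.Ico (-(1 / 2) : ℝ) (1 / 2)}

/-- A function `f : Ω × ℝ^d → ℂ` is stationary (with respect to the `ℤ^d`-action `τ` on `Ω`)
if for every `k ∈ ℤ^d` one has `f(τ_k ω, x) = f(ω, x + k)` for almost every `(ω, x)`. -/
def Stationary {d : ℕ} {Ω : Type} [MeasurableSpace Ω] (P : Measure Ω)
    (τ : (Fin d → ℤ) → Ω → Ω) (f : Ω → (Fin d → ℝ) → ℂ) : Prop :=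
  ∀ k : Fin d → ℤ, ∀ᵐ z ∂(P.prod (volume : Measure (Fin d → ℝ))),
    f (τ k z.1) z.2 = f z.1 (z.2 + fun i => (k i : ℝ))

open Filter Function Topology in
/-- On a finite measure space, a closed subspace of `Lᵖ`, `p < ∞`, which contains the constant `1`
and the indicators of a generating `π`-system is everything. -/
lemma submodule_eq_top_of_indicator_mem {α : Type*} [mα : MeasurableSpace α] {μ : Measure α}
    [IsFiniteMeasure μ] {p : ℝ≥0∞} [Fact (1 ≤ p)] (hp : p ≠ ∞) (M : Submodule ℂ (Lp ℂ p μ))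
    (hM : IsClosed (M : Set (Lp ℂ p μ))) {S : Set (Set α)}
    (hgen : mα = MeasurableSpace.generateFrom S) (hpi : IsPiSystem S)
    (huniv : indicatorConstLp p MeasurableSet.univ (measure_ne_top μ _) (1 : ℂ) ∈ M)
    (hS : ∀ t (ht : MeasurableSet t), t ∈ S →
      indicatorConstLp p ht (measure_ne_top μ _) (1 : ℂ) ∈ M) : M = ⊤ := by
  have key : ∀ t (ht : MeasurableSet t),
      indicatorConstLp p ht (measure_ne_top μ _) (1 : ℂ) ∈ M := by
    refine MeasurableSpace.induction_on_inter hgen hpi ?_ (fun t ht => hS t _ ht) ?_ ?_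
    · simp
    · intro t ht htM
      have h := indicatorConstLp_disjoint_union (p := p) ht ht.compl (measure_ne_top μ _)
        (measure_ne_top μ _) disjoint_compl_right (1 : ℂ)
      simp only [union_compl_self] at h
      rw [h] at huniv
      exact (M.add_mem_iff_right htM).1 huniv
    · intro s hd hs hsM
      have hacc : ∀ n, MeasurableSet (accumulate s n) := fun n =>
        MeasurableSet.biUnion (to_countable _) fun i _ => hs i
      have haccM : ∀ n, indicatorConstLp p (hacc n) (measure_ne_top μ _) (1 : ℂ) ∈ M := by
        intro n
        induction n with
        | zero => simpa only [accumulate_zero_nat] using hsM 0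
        | succ n ih =>
          have h := indicatorConstLp_disjoint_union (p := p) (hacc n) (hs (n + 1))
            (measure_ne_top μ _) (measure_ne_top μ _)
            (disjoint_accumulate hd n.lt_succ_self) (1 : ℂ)
          simp only [accumulate_succ, h]
          exact M.add_mem ih (hsM _)
      refine hM.mem_of_tendsto (b := atTop) (tendsto_indicatorConstLp_set (t := accumulate s)
        (ht := hacc) (hμt := fun n => measure_ne_top μ _) hp ?_) (Eventually.of_forall haccM)
      have hlim := tendsto_measure_iInter_atTop (μ := μ) (s := fun n => (⋃ i, s i) \ accumulate s n)
        (fun n => ((MeasurableSet.iUnion hs).diff (hacc n)).nullMeasurableSet)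
        (fun m n hmn => sdiff_subset_sdiff_right (monotone_accumulate hmn))
        ⟨0, measure_ne_top μ _⟩
      rw [← sdiff_iUnion, iUnion_accumulate, sdiff_self, measure_empty] at hlim
      refine hlim.congr fun n => ?_
      rw [Function.comp_apply, symmDiff_of_le (accumulate_subset_iUnion n)]
  refine Submodule.eq_top_iff'.2 fun f => ?_
  induction f using Lp.induction hp with
  | @indicatorConst c s hs hμs =>
    rw [Lp.simpleFunc.coe_indicatorConst]
    have h : indicatorConstLp p hs hμs.ne c = c • indicatorConstLp p hs hμs.ne (1 : ℂ) := by
      ext1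
      filter_upwards [indicatorConstLp_coeFn (p := p) (hs := hs) (hμs := hμs.ne) (c := c),
        indicatorConstLp_coeFn (p := p) (hs := hs) (hμs := hμs.ne) (c := (1 : ℂ)),
        Lp.coeFn_smul c (indicatorConstLp p hs hμs.ne (1 : ℂ))] with x h1 h2 h3
      rw [h1, h3, Pi.smul_apply, h2]
      by_cases hx : x ∈ s <;> simp [hx]
    rw [h]
    exact M.smul_mem c (key _ hs)
  | add _ _ _ hf hg => exact M.add_mem hf hg
  | isClosed => exact hM

open Function in
/-- Smooth approximation of the indicator of a measurable set by functions supported in an open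
set of full measure. -/
lemma exists_contDiff_eq_indicator_off {E : Type*} [NormedAddCommGroup E] [NormedSpace ℝ E]
    [FiniteDimensional ℝ E] [MeasurableSpace E] [BorelSpace E] (ν : Measure E) [IsFiniteMeasure ν]
    {U : Set E} (hU : IsOpen U) (hνU : ν Uᶜ = 0) {B : Set E} (hB : MeasurableSet B)
    {δ : ℝ≥0∞} (hδ : δ ≠ 0) :
    ∃ (g : E → ℝ) (D : Set E), ContDiff ℝ (⊤ : ℕ∞) g ∧ support g ⊆ U ∧ (∀ x, g x ∈ Icc 0 1) ∧
      MeasurableSet D ∧ ν D < δ ∧ ∀ x ∉ D, g x = B.indicator 1 x := by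
  have hδ2 : δ / 2 ≠ 0 := (ENNReal.half_pos hδ).ne'
  obtain ⟨V, hBV, hV, -, hVB⟩ := hB.exists_isOpen_sdiff_lt (measure_ne_top ν _) hδ2
  obtain ⟨K, hKB, hK, hBK⟩ :=
    (hB.inter hU.measurableSet).exists_isCompact_sdiff_lt (measure_ne_top ν _) hδ2
  obtain ⟨g, hg, hg01, hgs, hgK⟩ := exists_contMDiff_support_eq_eq_one_iff (n := ⊤)
    (modelWithCornersSelf ℝ E) (hV.inter hU) hK.isClosed
    (hKB.trans (inter_subset_inter_left _ hBV))
  refine ⟨g, (V \ B) ∪ ((B ∩ U) \ K) ∪ Uᶜ, contMDiff_iff_contDiff.1 hg,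
    hgs.trans_subset inter_subset_right, fun x => hg01 ⟨x, rfl⟩,
    ((hV.measurableSet.diff hB).union ((hB.inter hU.measurableSet).diff hK.measurableSet)).union
      hU.measurableSet.compl, ?_, fun x hx => ?_⟩
  · calc _ ≤ ν (V \ B) + ν ((B ∩ U) \ K) + ν Uᶜ :=
          (measure_union_le _ _).trans (by gcongr; exact measure_union_le _ _)
      _ < δ / 2 + δ / 2 := by rw [hνU, add_zero]; exact ENNReal.add_lt_add hVB hBK
      _ = δ := ENNReal.add_halves δ
  · simp only [mem_union, mem_sdiff, mem_inter_iff, mem_compl_iff, not_or, not_and, not_not] at hx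
    by_cases hxB : x ∈ B
    · rw [indicator_of_mem hxB, (hgK x).1 (hx.1.2 ⟨hxB, hx.2⟩), Pi.one_apply]
    · rw [indicator_of_notMem hxB, ← notMem_support, hgs]
      exact fun h => hxB (hx.1.1 h.1)

/-- The open unit cube `(-1/2, 1/2)^d`. -/
def openUnitCube (d : ℕ) : Set (Fin d → ℝ) :=
  Set.univ.pi fun _ => Ioo (-(1 / 2) : ℝ) (1 / 2)

lemma isOpen_openUnitCube (d : ℕ) : IsOpen (openUnitCube d) :=
  isOpen_set_pi finite_univ fun _ _ => isOpen_Ioo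

lemma unitCube_eq_pi (d : ℕ) :
    unitCube d = Set.univ.pi fun _ => Ico (-(1 / 2) : ℝ) (1 / 2) := by
  ext x; simp [unitCube]

lemma measurableSet_unitCube (d : ℕ) : MeasurableSet (unitCube d) := by
  rw [unitCube_eq_pi]
  exact MeasurableSet.univ_pi fun _ => measurableSet_Ico

lemma isBounded_unitCube (d : ℕ) : Bornology.IsBounded (unitCube d) := by
  rw [unitCube_eq_pi]
  exact Bornology.IsBounded.pi fun _ => Metric.isBounded_Ico _ _

lemma openUnitCube_subset_unitCube (d : ℕ) : openUnitCube d ⊆ unitCube d := by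
  rw [unitCube_eq_pi]
  exact Set.pi_mono fun _ _ => Ioo_subset_Ico_self

instance isFiniteMeasure_restrict_unitCube (d : ℕ) :
    IsFiniteMeasure ((volume : Measure (Fin d → ℝ)).restrict (unitCube d)) :=
  isFiniteMeasure_restrict.2 (isBounded_unitCube d).measure_lt_top.ne

lemma restrict_unitCube_compl_openUnitCube (d : ℕ) :
    (volume : Measure (Fin d → ℝ)).restrict (unitCube d) (openUnitCube d)ᶜ = 0 := by
  rw [Measure.restrict_apply (isOpen_openUnitCube d).measurableSet.compl, inter_comm,
    ← sdiff_eq, ← ae_le_set, unitCube_eq_pi]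
  exact (Measure.univ_pi_Ico_ae_eq_Icc.trans Measure.univ_pi_Ioo_ae_eq_Icc.symm).le

/-- Translates of the unit cube by distinct integer vectors are disjoint. -/
lemma eq_zero_of_sub_mem_unitCube {d : ℕ} {x : Fin d → ℝ} {k : Fin d → ℤ} (hx : x ∈ unitCube d)
    (hxk : (x - fun j => (k j : ℝ)) ∈ unitCube d) : k = 0 := by
  ext j
  have h1 := hx j
  have h2 := hxk j
  simp only [Pi.sub_apply, mem_Ico] at h1 h2
  have h3 : (k j : ℝ) < 1 := by linarith
  have h4 : (-1 : ℝ) < k j := by linarith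
  have h5 : k j < 1 := by exact_mod_cast h3
  have h6 : -1 < k j := by exact_mod_cast h4
  simp only [Pi.zero_apply]
  omega

/-- On the unit cube, only `k = 0` contributes to `Φ_{χ,Y}` when `χ` is supported in the cube. -/
lemma tsum_translates_eq {d : ℕ} {Ω : Type*} (τ : (Fin d → ℤ) → Ω → Ω) (Y : Ω → ℂ)
    {χ : (Fin d → ℝ) → ℂ} (hχ : Function.support χ ⊆ unitCube d) (ω : Ω) {x : Fin d → ℝ}
    (hx : x ∈ unitCube d) :
    ∑' k : Fin d → ℤ, Y (τ k ω) * χ (x - fun j => (k j : ℝ)) = Y (τ 0 ω) * χ x := by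
  rw [tsum_eq_single 0]
  · congr 2
    ext j
    simp
  · intro k hk
    have : χ (x - fun j => (k j : ℝ)) = 0 :=
      Function.notMem_support.1 fun h => hk (eq_zero_of_sub_mem_unitCube hx (hχ h))
    rw [this, mul_zero]

open Function in
/-- Finite sums of products of a bounded random variable and a Schwartz function supported in the
unit cube are dense in `Lᵖ(Ω × Q)`. -/
lemma exists_sum_mul_schwartz_eLpNorm_sub_lt {d : ℕ} {Ω : Type*} [MeasurableSpace Ω]
    (P : Measure Ω) [IsProbabilityMeasure P] {p : ℝ≥0∞} [Fact (1 ≤ p)] (hp : p ≠ ∞)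
    {f : Ω × (Fin d → ℝ) → ℂ} (hf : MemLp f p (P.prod (volume.restrict (unitCube d))))
    {ε : ℝ} (hε : 0 < ε) :
    ∃ (n : ℕ) (Y : Fin n → Ω → ℂ) (χ : Fin n → SchwartzMap (Fin d → ℝ) ℂ),
      (∀ i, Measurable (Y i)) ∧ (∀ i, ∃ M : ℝ, ∀ ω, ‖Y i ω‖ ≤ M) ∧
      (∀ i, support (χ i) ⊆ unitCube d) ∧
      eLpNorm (fun z => f z - ∑ i, Y i z.1 * χ i z.2) p
        (P.prod (volume.restrict (unitCube d))) < ENNReal.ofReal ε := by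
  set ν : Measure (Fin d → ℝ) := volume.restrict (unitCube d)
  set T : Set (Lp ℂ p (P.prod ν)) := {h | ∃ (Y : Ω → ℂ) (χ : SchwartzMap (Fin d → ℝ) ℂ),
    Measurable Y ∧ (∃ M : ℝ, ∀ ω, ‖Y ω‖ ≤ M) ∧ support χ ⊆ unitCube d ∧
      h =ᵐ[P.prod ν] fun z => Y z.1 * χ z.2}
  have hrect : ∀ A : Set Ω, MeasurableSet A → ∀ B : Set (Fin d → ℝ), MeasurableSet B →
      ∀ hAB : MeasurableSet (A ×ˢ B), indicatorConstLp p hAB (measure_ne_top (P.prod ν) _) (1 : ℂ) ∈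
        (Submodule.span ℂ T).topologicalClosure := by
    intro A hA B hB hAB
    rw [← SetLike.mem_coe, Submodule.topologicalClosure_coe, EMetric.mem_closure_iff]
    intro η hη
    have hp0 : 0 < p.toReal := ENNReal.toReal_pos (one_pos.trans_le Fact.out).ne' hp
    obtain ⟨δ, hδ, hδη⟩ : ∃ δ : ℝ≥0∞, δ ≠ 0 ∧ δ ^ (1 / p.toReal) ≤ η := by
      refine ⟨η ^ p.toReal, by simp [hη.ne', hp0.le, hp0], ?_⟩
      rw [← ENNReal.rpow_mul, mul_one_div_cancel hp0.ne', ENNReal.rpow_one]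
    obtain ⟨g, D, hg, hgU, hg01, hD, hνD, hgD⟩ := exists_contDiff_eq_indicator_off ν
      (isOpen_openUnitCube d) (restrict_unitCube_compl_openUnitCube d) hB hδ
    replace hgU := hgU.trans (openUnitCube_subset_unitCube d)
    have hsupp : support (fun x => (g x : ℂ)) ⊆ unitCube d :=
      fun x hx => hgU fun h => hx (by simp [h])
    have hcpt : HasCompactSupport fun x => (g x : ℂ) :=
      ((isBounded_unitCube d).subset hsupp).isCompact_closure
    set χ : SchwartzMap (Fin d → ℝ) ℂ :=
      hcpt.toSchwartzMap (Complex.ofRealCLM.contDiff.comp hg)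
    have hχg : ∀ x, χ x = g x := fun _ => rfl
    have hYm : Measurable (A.indicator (1 : Ω → ℂ)) := measurable_one.indicator hA
    have hY1 : ∀ ω, ‖A.indicator (1 : Ω → ℂ) ω‖ ≤ 1 := fun ω => by
      by_cases h : ω ∈ A <;> simp [h]
    have hmem : MemLp (fun z : Ω × (Fin d → ℝ) => A.indicator (1 : Ω → ℂ) z.1 * χ z.2) p
        (P.prod ν) := by
      refine MemLp.of_bound ((hYm.comp measurable_fst).mul
        (χ.continuous.measurable.comp measurable_snd)).aestronglyMeasurable 1
        (ae_of_all _ fun z => ?_)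
      rw [norm_mul]
      refine mul_le_one₀ (hY1 _) (norm_nonneg _) ?_
      simpa [hχg, abs_of_nonneg (hg01 z.2).1] using (hg01 z.2).2
    refine ⟨hmem.toLp, Submodule.subset_span ⟨_, χ, hYm, ⟨1, hY1⟩, hsupp, hmem.coeFn_toLp⟩, ?_⟩
    rw [indicatorConstLp, Lp.edist_toLp_toLp]
    calc _ ≤ eLpNorm ((univ ×ˢ D).indicator fun _ => (1 : ℂ)) p (P.prod ν) := by
          refine eLpNorm_mono fun z => ?_
          have h0 := (hg01 z.2).1
          have h1 := (hg01 z.2).2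
          by_cases hzD : z.2 ∈ D
          · rw [indicator_of_mem (by simpa using hzD), norm_one]
            by_cases hzA : z.1 ∈ A <;> by_cases hzB : z.2 ∈ B <;>
              simp only [hχg, Pi.sub_apply, indicator, mem_prod, hzA, hzB, and_self,
                and_true, and_false, if_true, if_false, Pi.one_apply, one_mul, zero_mul, sub_self,
                norm_zero, zero_le_one]
            · rw [← Complex.ofReal_one, ← Complex.ofReal_sub, Complex.norm_real, Real.norm_eq_abs,
                abs_le]
              constructor <;> linarith
            · rw [zero_sub, norm_neg, Complex.norm_real, Real.norm_eq_abs, abs_le]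
              constructor <;> linarith
          · have h2 := hgD _ hzD
            by_cases hzA : z.1 ∈ A <;> by_cases hzB : z.2 ∈ B <;>
              simp [hχg, indicator, hzA, hzB, h2]
      _ ≤ ‖(1 : ℂ)‖ₑ * (P.prod ν) (univ ×ˢ D) ^ (1 / p.toReal) := eLpNorm_indicator_const_le _ _
      _ = ν D ^ (1 / p.toReal) := by simp [Measure.prod_prod]
      _ < δ ^ (1 / p.toReal) := ENNReal.rpow_lt_rpow hνD (by positivity)
      _ ≤ η := hδη
  have htop := submodule_eq_top_of_indicator_mem hp (Submodule.span ℂ T).topologicalClosure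
    (Submodule.isClosed_topologicalClosure _) generateFrom_prod.symm isPiSystem_prod
    (by
      have h := hrect univ .univ univ .univ
      simp only [univ_prod_univ] at h
      exact h .univ)
    (by
      rintro _ ht ⟨A, hA, B, hB, rfl⟩
      exact hrect A hA B hB ht)
  have hfmem : hf.toLp f ∈ (Submodule.span ℂ T).topologicalClosure := htop ▸ Submodule.mem_top
  rw [← SetLike.mem_coe, Submodule.topologicalClosure_coe, EMetric.mem_closure_iff] at hfmem
  obtain ⟨h, hh, hlt⟩ := hfmem (ENNReal.ofReal ε) (ENNReal.ofReal_pos.2 hε)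
  obtain ⟨n, c, t, rfl⟩ := Submodule.mem_span_set'.1 hh
  choose Y χ hY hYb hχ ht using fun i => (t i).2
  refine ⟨n, fun i ω => c i * Y i ω, χ, fun i => (hY i).const_mul _, fun i => ?_, hχ, ?_⟩
  · obtain ⟨M, hM⟩ := hYb i
    refine ⟨‖c i‖ * M, fun ω => ?_⟩
    rw [norm_mul]
    exact mul_le_mul_of_nonneg_left (hM ω) (norm_nonneg _)
  · rw [Lp.edist_def] at hlt
    refine (eLpNorm_congr_ae ?_).trans_lt hlt
    have hsm : ∀ᵐ z ∂(P.prod ν), ∀ i, (c i • (t i : Lp ℂ p (P.prod ν)) : Lp ℂ p (P.prod ν)) z =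
        c i * (Y i z.1 * χ i z.2) := by
      refine ae_all_iff.2 fun i => ?_
      filter_upwards [Lp.coeFn_smul (c i) (t i : Lp ℂ p (P.prod ν)), ht i] with z h1 h2
      rw [h1, Pi.smul_apply, h2, smul_eq_mul]
    filter_upwards [hsm, hf.coeFn_toLp,
      Lp.coeFn_finsetSum Finset.univ fun i => c i • (t i : Lp ℂ p (P.prod ν))] with z h1 h2 h3
    rw [Pi.sub_apply, h2, h3, Finset.sum_apply]
    simp only [h1, mul_assoc]

/-- **Density of the test functions `Φ_{χ,Y}` in `L^p_s`.**
Let `d ≥ 1`, let `τ` be an ergodic measure preserving `ℤ^d`-action on a probability space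
`Ω`, and let `1 ≤ p < ∞`.  The span of the functions
`Φ_{χ,Y}(ω,x) = Σ_{k ∈ ℤ^d} Y(τ_k ω) χ(x-k)`, with `Y ∈ L^∞(Ω)` and `χ` Schwartz, is
dense in `L^p_s`: for every stationary `f` with `E(∫_Q |f|^p) < ∞` and every `ε > 0` there
is a finite combination `Φ` of such functions with `E(∫_Q |f - Φ|^p) < ε^p`. -/
theorem density_of_test_functions_in_Lps
    (d : ℕ) (hd : 1 ≤ d)
    (Ω : Type) [MeasurableSpace Ω] (P : Measure Ω) [IsProbabilityMeasure P]
    (τ : (Fin d → ℤ) → Ω → Ω)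
    (hmp : ∀ k, MeasurePreserving (τ k) P P)
    (hadd : ∀ k l, τ (k + l) = τ k ∘ τ l)
    (herg : ∀ A : Set Ω, MeasurableSet A → (∀ k, τ k ⁻¹' A = A) → P A = 0 ∨ P A = 1)
    (p : ℝ) (hp : 1 ≤ p)
    (f : Ω → (Fin d → ℝ) → ℂ) (hfmeas : Measurable (Function.uncurry f))
    (hfstat : Stationary P τ f)
    (hfLp : (∫⁻ z in Set.univ ×ˢ unitCube d, (‖f z.1 z.2‖₊ : ℝ≥0∞) ^ p
        ∂(P.prod (volume : Measure (Fin d → ℝ)))) < ∞)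
    (ε : ℝ) (hε : 0 < ε) :
    ∃ (n : ℕ) (Y : Fin n → Ω → ℂ) (χ : Fin n → SchwartzMap (Fin d → ℝ) ℂ),
      (∀ i, Measurable (Y i)) ∧
      (∀ i, ∃ M : ℝ, ∀ᵐ ω ∂P, ‖Y i ω‖ ≤ M) ∧
      (∫⁻ z in Set.univ ×ˢ unitCube d,
          (‖f z.1 z.2 - ∑ i, ∑' k : Fin d → ℤ,
              Y i (τ k z.1) * χ i (z.2 - fun j => (k j : ℝ))‖₊ : ℝ≥0∞) ^ p
          ∂(P.prod (volume : Measure (Fin d → ℝ)))) < ENNReal.ofReal (ε ^ p) := by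
  have hp0 : 0 < p := one_pos.trans_le hp
  have hq0 : ENNReal.ofReal p ≠ 0 := (ENNReal.ofReal_pos.2 hp0).ne'
  have hqp : (ENNReal.ofReal p).toReal = p := ENNReal.toReal_ofReal hp0.le
  have : Fact (1 ≤ ENNReal.ofReal p) := ⟨by simpa using ENNReal.ofReal_le_ofReal hp⟩
  set ν : Measure (Fin d → ℝ) := volume.restrict (unitCube d)
  have hμ : (P.prod (volume : Measure (Fin d → ℝ))).restrict (Set.univ ×ˢ unitCube d) =
      P.prod ν := by
    rw [← Measure.prod_restrict, Measure.restrict_univ]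
  rw [hμ] at hfLp ⊢
  have hf : MemLp (Function.uncurry f) (ENNReal.ofReal p) (P.prod ν) := by
    refine ⟨hfmeas.aestronglyMeasurable, ?_⟩
    rw [eLpNorm_lt_top_iff_lintegral_rpow_enorm_lt_top hq0 ENNReal.ofReal_ne_top, hqp]
    exact hfLp
  obtain ⟨n, Y, χ, hY, hYb, hχ, hlt⟩ :=
    exists_sum_mul_schwartz_eLpNorm_sub_lt P ENNReal.ofReal_ne_top hf hε
  refine ⟨n, Y, χ, hY, fun i => (hYb i).imp fun M hM => ae_of_all _ hM, ?_⟩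
  have hstat0 : ∀ᵐ z ∂(P.prod ν), f (τ 0 z.1) z.2 = f z.1 z.2 := by
    have h := ae_restrict_of_ae (s := Set.univ ×ˢ unitCube d) (hfstat 0)
    rw [hμ] at h
    filter_upwards [h] with z hz
    rw [hz]
    congr 1
    ext j
    simp
  have hcube : ∀ᵐ z ∂(P.prod ν), z.2 ∈ unitCube d := by
    rw [← hμ]
    filter_upwards [ae_restrict_mem (MeasurableSet.univ.prod (measurableSet_unitCube d))] with z hz
    exact hz.2
  have hτ : MeasurePreserving (Prod.map (τ 0) id) (P.prod ν) (P.prod ν) :=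
    (hmp 0).prod (MeasurePreserving.id ν)
  have hmeas : Measurable fun z : Ω × (Fin d → ℝ) =>
      Function.uncurry f z - ∑ i, Y i z.1 * χ i z.2 :=
    hfmeas.sub (Finset.measurable_sum _ fun i _ => ((hY i).comp measurable_fst).mul
      ((χ i).continuous.measurable.comp measurable_snd))
  rw [← eLpNorm_comp_measurePreserving hmeas.aestronglyMeasurable hτ,
    eLpNorm_eq_eLpNorm' hq0 ENNReal.ofReal_ne_top, hqp] at hlt
  calc _ = ∫⁻ z, ‖((fun z : Ω × (Fin d → ℝ) => Function.uncurry f z - ∑ i, Y i z.1 * χ i z.2) ∘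
          Prod.map (τ 0) id) z‖ₑ ^ p ∂(P.prod ν) := by
        refine lintegral_congr_ae ?_
        filter_upwards [hstat0, hcube] with z hz hzQ
        simp only [tsum_translates_eq τ _ (hχ _) z.1 hzQ, ← hz]
        rfl
    _ < ENNReal.ofReal (ε ^ p) := by
        rw [lintegral_rpow_enorm_eq_rpow_eLpNorm' hp0, ← ENNReal.ofReal_rpow_of_pos hε]
        exact ENNReal.rpow_lt_rpow hlt hp0
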